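/- arXiv:2211.05038 — 13 statements merged into one kernel-verified Lean document; each statement's English description precedes it below -/
import Mathlib

section
/- Let l be a positive natural number and p : Fin l → ℕ with p i ≥ 1 for all i, and let f : (∀ i, ZMod (p i)) → (∀ i, ZMod (p i)) be the map (f v) i = v i + 1. Consider the orbit equivalence relation on ∀ i, ZMod (p i) given by v ~ w iff there exist k m : ℕ with f^[k] v = f^[m] w. Then the number of equivalence classes (orbits of f) equals (∏ i, p i) / Finset.univ.lcm p. -/
theorem AddSubgroup.neg_add_mem_zmultiples_iff_exists_iterate {G : Type*} [AddCommGroup G]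
    (a v w : G) :
    -v + w ∈ AddSubgroup.zmultiples a ↔ ∃ k m : ℕ, (· + a)^[k] v = (· + a)^[m] w := by
  simp only [add_right_iterate, AddSubgroup.mem_zmultiples_iff]
  constructor
  · rintro ⟨z, hz⟩
    refine ⟨z.toNat, (-z).toNat, ?_⟩
    rw [← Int.toNat_sub_toNat_neg z, sub_zsmul, natCast_zsmul, natCast_zsmul, ← sub_eq_add_neg,
      sub_eq_iff_eq_add] at hz
    rw [hz]
    abel
  · rintro ⟨k, m, h⟩
    refine ⟨(k : ℤ) - m, ?_⟩
    rw [sub_zsmul, natCast_zsmul, natCast_zsmul, ← sub_eq_add_neg, sub_eq_iff_eq_add, add_assoc,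
      ← h]
    abel

theorem ZMod.addOrderOf_pi_one {ι : Type*} [Fintype ι] (p : ι → ℕ) :
    addOrderOf (1 : ∀ i, ZMod (p i)) = Finset.univ.lcm p := by
  simp [Pi.addOrderOf, ZMod.addOrderOf_one]

theorem AddSubgroup.card_quotient_zmultiples {G : Type*} [AddGroup G] [Finite G] (a : G) :
    Nat.card (G ⧸ AddSubgroup.zmultiples a) = Nat.card G / addOrderOf a := by
  rw [AddSubgroup.card_eq_card_quotient_mul_card_addSubgroup (AddSubgroup.zmultiples a),
    Nat.card_zmultiples, Nat.mul_div_cancel _ (addOrderOf_pos a)]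

theorem stmt_2 (l : ℕ) (hl : 0 < l) (p : Fin l → ℕ) (hp : ∀ i, 1 ≤ p i) :
    Nat.card (Quot (fun v w : ∀ i, ZMod (p i) =>
      ∃ k m : ℕ,
        (fun (u : ∀ i, ZMod (p i)) (i : Fin l) => u i + 1)^[k] v =
          (fun (u : ∀ i, ZMod (p i)) (i : Fin l) => u i + 1)^[m] w)) =
      (∏ i, p i) / Finset.univ.lcm p := by
  have (i : Fin l) : NeZero (p i) := ⟨Nat.one_le_iff_ne_zero.mp (hp i)⟩
  calc
    _ = Nat.card ((∀ i, ZMod (p i)) ⧸ AddSubgroup.zmultiples (1 : ∀ i, ZMod (p i))) :=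
      Nat.card_congr (Quot.congrRight fun v w => by
        rw [QuotientAddGroup.leftRel_apply,
          AddSubgroup.neg_add_mem_zmultiples_iff_exists_iterate]
        rfl)
    _ = _ := by
      rw [AddSubgroup.card_quotient_zmultiples, ZMod.addOrderOf_pi_one]
      simp
end

section
/- Let l ≥ 1 and let p, n : Fin l → ℕ take only positive values. Then the l-fold cycle product ⊙_{i : Fin l} Finsupp.single (p i) (n i) equals Finsupp.single L ((∏ i, p i * n i) / L), where L = Finset.univ.lcm p. In the dynamical interpretation: ⊙_{i=1}^{l} C^{n_i}_{p_i} = C^{(∏_i p_i n_i)/λ_l}_{λ_l} with λ_l = lcm(p₁,…,p_l). -/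
/-- The cycle product of two unions of disjoint cycles: `(f ⊙ g) r` equals
`∑_{p ∈ f.support} ∑_{q ∈ g.support, lcm p q = r} f p * g q * (p * q / lcm p q)`. -/
noncomputable def cycProd (f g : ℕ →₀ ℕ) : ℕ →₀ ℕ :=
  ∑ p ∈ f.support, ∑ q ∈ g.support,
    Finsupp.single (Nat.lcm p q) (f p * g q * (p * q / Nat.lcm p q))

/-- Iterated cycle power: `f^{⊙0} = C¹₁` and `f^{⊙(k+1)} = f ⊙ f^{⊙k}`. -/
noncomputable def cycPow (f : ℕ →₀ ℕ) : ℕ → ℕ →₀ ℕ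
  | 0 => Finsupp.single 1 1
  | k + 1 => cycProd f (cycPow f k)

/-- The `l`-fold cycle product `⊙ᵢ f i` (empty product `C¹₁`). -/
noncomputable def cycProdMulti {l : ℕ} (f : Fin l → (ℕ →₀ ℕ)) : ℕ →₀ ℕ :=
  (List.ofFn f).foldr cycProd (Finsupp.single 1 1)

theorem cycProd_single_single (p q a b : ℕ) :
    cycProd (Finsupp.single p a) (Finsupp.single q b) =
      Finsupp.single (Nat.lcm p q) (a * b * (p * q / Nat.lcm p q)) := by
  unfold cycProd
  rcases eq_or_ne a 0 with rfl | ha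
  · simp
  rcases eq_or_ne b 0 with rfl | hb
  · simp
  simp [Finsupp.support_single _ ha, Finsupp.support_single _ hb]

theorem mul_div_mul_mul_div_lcm (p a q P : ℕ) (h : q ∣ P) :
    a * (P / q) * (p * q / Nat.lcm p q) = p * a * P / Nat.lcm p q := by
  rcases Nat.eq_zero_or_pos q with rfl | hq
  · simp
  obtain ⟨k, rfl⟩ := h
  rw [Nat.mul_div_cancel_left _ hq, ← Nat.mul_div_assoc _ (Nat.lcm_dvd_mul p q)]
  congr 1
  ring

theorem cycProdMulti_succ {l : ℕ} (f : Fin (l + 1) → (ℕ →₀ ℕ)) :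
    cycProdMulti f = cycProd (f 0) (cycProdMulti fun i => f i.succ) := by
  simp [cycProdMulti, List.ofFn_succ]

theorem lcm_univ_dvd_prod_mul {ι : Type*} [Fintype ι] (p n : ι → ℕ) :
    Finset.univ.lcm p ∣ ∏ i, p i * n i :=
  Finset.lcm_dvd fun i hi =>
    (Dvd.intro (n i) rfl).trans (Finset.dvd_prod_of_mem (fun i => p i * n i) hi)

theorem lcm_univ_fin_succ {l : ℕ} (p : Fin (l + 1) → ℕ) :
    Finset.univ.lcm p = Nat.lcm (p 0) (Finset.univ.lcm fun i : Fin l => p i.succ) := by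
  refine Nat.dvd_antisymm (Finset.lcm_dvd fun i _ => ?_) (Nat.lcm_dvd ?_ ?_)
  · refine Fin.cases (Nat.dvd_lcm_left _ _) (fun j => ?_) i
    exact (Finset.dvd_lcm (f := fun i : Fin l => p i.succ) (Finset.mem_univ j)).trans
      (Nat.dvd_lcm_right _ _)
  · exact Finset.dvd_lcm (Finset.mem_univ 0)
  · exact Finset.lcm_dvd fun j _ => Finset.dvd_lcm (Finset.mem_univ j.succ)

theorem cycProdMulti_single (l : ℕ) (p n : Fin l → ℕ) :
    cycProdMulti (fun i => Finsupp.single (p i) (n i)) =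
      Finsupp.single (Finset.univ.lcm p) ((∏ i, p i * n i) / Finset.univ.lcm p) := by
  induction l with
  | zero => simp [cycProdMulti]
  | succ l ih =>
    rw [cycProdMulti_succ, ih (fun i => p i.succ) (fun i => n i.succ), cycProd_single_single,
      mul_div_mul_mul_div_lcm _ _ _ _ (lcm_univ_dvd_prod_mul _ _), lcm_univ_fin_succ,
      Fin.prod_univ_succ]

theorem stmt_5 (l : ℕ) (hl : 1 ≤ l) (p n : Fin l → ℕ)
    (hp : ∀ i, 0 < p i) (hn : ∀ i, 0 < n i) :
    cycProdMulti (fun i => Finsupp.single (p i) (n i)) =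
      Finsupp.single (Finset.univ.lcm p) ((∏ i, p i * n i) / Finset.univ.lcm p) :=
  cycProdMulti_single l p n
end

section
/- Let l > 1, w > 1 be natural numbers, and let p, n : Fin l → ℕ take only positive values, with the p i pairwise distinct. Then the w-th cycle power of ∑_{i : Fin l} Finsupp.single (p i) (n i) equals the sum, over all functions k : Fin l → ℕ with ∑ i, k i = w, of Finsupp.single (λ* k) ((Nat.multinomial Finset.univ k) * (∏ i, (p i * n i)^(k i)) / (λ* k)), where λ* k denotes the least common multiple of the p i over those indices i with k i ≠ 0 (and λ* k = 1 if all k i = 0). In the dynamical interpretation: (⊕_{i=1}^{l} C^{n_i}_{p_i})^{⊙w} = ⊕_{k₁+⋯+k_l = w} (w choose k₁,…,k_l) · C^{(1/λ*)∏_i (p_i n_i)^{k_i}}_{λ*}. -/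
/-- The number of points fixed by the `m`-th iterate of a union of cycles: the sum of the sizes
of the cycles whose length divides `m`. -/
noncomputable def fixedPoints (m : ℕ) : (ℕ →₀ ℕ) →+ ℕ :=
  Finsupp.liftAddHom fun p => AddMonoidHom.mulLeft (if p ∣ m then p else 0)

lemma fixedPoints_single (m p a : ℕ) :
    fixedPoints m (Finsupp.single p a) = if p ∣ m then p * a else 0 := by
  simp [fixedPoints]

lemma fixedPoints_eq_sum (m : ℕ) (f : ℕ →₀ ℕ) :
    fixedPoints m f = ∑ p ∈ f.support, if p ∣ m then p * f p else 0 := by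
  simp [fixedPoints, Finsupp.sum]

lemma fixedPoints_eq_sum_divisors {m : ℕ} (hm : m ≠ 0) (f : ℕ →₀ ℕ) :
    fixedPoints m f = ∑ p ∈ m.divisors, p * f p := by
  rw [fixedPoints_eq_sum, ← Finset.sum_filter]
  refine Finset.sum_subset (fun p hp => ?_) fun p hp hp' => ?_
  · simpa [hm] using (Finset.mem_filter.1 hp).2
  · simp_all

lemma fixedPoints_cycProd (m : ℕ) (f g : ℕ →₀ ℕ) :
    fixedPoints m (cycProd f g) = fixedPoints m f * fixedPoints m g := by
  simp only [cycProd, map_sum, fixedPoints_single, fixedPoints_eq_sum m f,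
    fixedPoints_eq_sum m g, Finset.sum_mul_sum]
  refine Finset.sum_congr rfl fun p _ => Finset.sum_congr rfl fun q _ => ?_
  have h : p.lcm q * (f p * g q * (p * q / p.lcm q)) = p * f p * (q * g q) := by
    rw [mul_left_comm, Nat.mul_div_cancel' (Nat.lcm_dvd_mul p q)]
    ring
  simp only [h, Nat.lcm_dvd_iff, ite_zero_mul_ite_zero]

lemma fixedPoints_cycPow (m : ℕ) (f : ℕ →₀ ℕ) (w : ℕ) :
    fixedPoints m (cycPow f w) = fixedPoints m f ^ w := by
  induction w with
  | zero => simp [cycPow, fixedPoints_single]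
  | succ w ih => rw [cycPow, fixedPoints_cycProd, ih, pow_succ']

/-- A union of cycles of positive length is determined by its numbers of fixed points. -/
lemma eq_of_fixedPoints_eq {f g : ℕ →₀ ℕ} (h0 : f 0 = g 0)
    (h : ∀ m ≠ 0, fixedPoints m f = fixedPoints m g) : f = g := by
  ext m
  induction m using Nat.strong_induction_on with
  | _ m ih =>
    rcases eq_or_ne m 0 with rfl | hm
    · exact h0
    · have key := h m hm
      rw [fixedPoints_eq_sum_divisors hm, fixedPoints_eq_sum_divisors hm,
        ← Nat.cons_self_properDivisors hm, Finset.sum_cons, Finset.sum_cons,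
        Finset.sum_congr rfl fun p hp => by rw [ih p (Nat.mem_properDivisors.1 hp).2]] at key
      exact Nat.eq_of_mul_eq_mul_left (Nat.pos_of_ne_zero hm) (Nat.add_right_cancel key)

lemma cycProd_apply_zero {f g : ℕ →₀ ℕ} (hf : f 0 = 0) (hg : g 0 = 0) : cycProd f g 0 = 0 := by
  simp only [cycProd, Finsupp.finsetSum_apply]
  refine Finset.sum_eq_zero fun p hp => Finset.sum_eq_zero fun q hq => ?_
  refine Finsupp.single_eq_of_ne (Nat.lcm_ne_zero ?_ ?_).symm
  · rintro rfl
    exact Finsupp.mem_support_iff.1 hp hf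
  · rintro rfl
    exact Finsupp.mem_support_iff.1 hq hg

lemma cycPow_apply_zero {f : ℕ →₀ ℕ} (hf : f 0 = 0) (w : ℕ) : cycPow f w 0 = 0 := by
  induction w with
  | zero => simp [cycPow]
  | succ w ih => exact cycProd_apply_zero hf ih

lemma fixedPoints_multinomial_term {ι : Type*} [Fintype ι] (m : ℕ) (p n k : ι → ℕ) :
    fixedPoints m (Finsupp.single ((Finset.univ.filter (fun i => k i ≠ 0)).lcm p)
        (Nat.multinomial Finset.univ k * (∏ i, (p i * n i) ^ k i) /
          (Finset.univ.filter (fun i => k i ≠ 0)).lcm p)) =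
      Nat.multinomial Finset.univ k * ∏ i, (if p i ∣ m then p i * n i else 0) ^ k i := by
  have hdvd : (Finset.univ.filter (fun i => k i ≠ 0)).lcm p ∣
      Nat.multinomial Finset.univ k * ∏ i, (p i * n i) ^ k i := by
    refine Finset.lcm_dvd fun i hi => Dvd.dvd.mul_left ?_ _
    exact ((dvd_mul_right (p i) (n i)).trans (dvd_pow_self _ (Finset.mem_filter.1 hi).2)).trans
      (Finset.dvd_prod_of_mem (fun i => (p i * n i) ^ k i) (Finset.mem_univ i))
  rw [fixedPoints_single, Nat.mul_div_cancel' hdvd]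
  simp only [Finset.lcm_dvd_iff]
  split_ifs with h
  · congr 1
    refine Finset.prod_congr rfl fun i _ => ?_
    by_cases hk : k i = 0
    · simp [hk]
    · rw [if_pos (h i (by simpa using hk))]
  · push Not at h
    obtain ⟨i, hi, him⟩ := h
    rw [Finset.prod_eq_zero (Finset.mem_univ i), mul_zero]
    rw [if_neg him, zero_pow (Finset.mem_filter.1 hi).2]

theorem stmt_7 (l w : ℕ) (hl : 1 < l) (hw : 1 < w) (p n : Fin l → ℕ)
    (hp : ∀ i, 0 < p i) (hn : ∀ i, 0 < n i) (hpinj : Function.Injective p) :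
    cycPow (∑ i, Finsupp.single (p i) (n i)) w =
      ∑ k ∈ Finset.Nat.antidiagonalTuple l w,
        Finsupp.single ((Finset.univ.filter (fun i => k i ≠ 0)).lcm p)
          (Nat.multinomial Finset.univ k * (∏ i, (p i * n i) ^ k i) /
            (Finset.univ.filter (fun i => k i ≠ 0)).lcm p) := by
  refine eq_of_fixedPoints_eq ?_ fun m _ => ?_
  · rw [cycPow_apply_zero, Finsupp.finsetSum_apply]
    · refine (Finset.sum_eq_zero fun k _ => Finsupp.single_eq_of_ne (Ne.symm ?_)).symm
      simpa [Finset.lcm_eq_zero_iff] using fun i _ => (hp i).ne'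
    · rw [Finsupp.finsetSum_apply]
      exact Finset.sum_eq_zero fun i _ => Finsupp.single_eq_of_ne (hp i).ne
  · have htuple : Finset.Nat.antidiagonalTuple l w = Finset.univ.piAntidiag w := by
      ext k
      simp [Finset.Nat.mem_antidiagonalTuple]
    rw [fixedPoints_cycPow]
    simp only [map_sum, fixedPoints_multinomial_term]
    simp only [fixedPoints_single, Finset.sum_pow_eq_sum_piAntidiag, htuple, Nat.cast_id]
end

section
/- For all f, g : ℕ →₀ ℕ whose supports contain only positive integers, the total number of periodic points is multiplicative under the cycle product: ∑_{r ∈ (f ⊙ g).support} r * (f ⊙ g) r = (∑_{p ∈ f.support} p * f p) * (∑_{q ∈ g.support} q * g q). -/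
/-- The number of points of a cycle product, as a sum over pairs of cycle lengths. -/
theorem sum_mul_cycProd (f g : ℕ →₀ ℕ) :
    (cycProd f g).sum (fun r n => r * n) =
      ∑ p ∈ f.support, ∑ q ∈ g.support,
        Nat.lcm p q * (f p * g q * (p * q / Nat.lcm p q)) := by
  have h_zero : ∀ r : ℕ, r * 0 = 0 := fun r => mul_zero r
  have h_add : ∀ r m n : ℕ, r * (m + n) = r * m + r * n := fun r m n => mul_add r m n
  rw [cycProd, ← Finsupp.sum_finsetSum_index h_zero h_add]
  refine Finset.sum_congr rfl fun p _ => ?_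
  rw [← Finsupp.sum_finsetSum_index h_zero h_add]
  exact Finset.sum_congr rfl fun q _ => Finsupp.sum_single_index (mul_zero _)

theorem stmt_8 (f g : ℕ →₀ ℕ)
    (hf : ∀ p ∈ f.support, 0 < p) (hg : ∀ q ∈ g.support, 0 < q) :
    ∑ r ∈ (cycProd f g).support, r * cycProd f g r =
      (∑ p ∈ f.support, p * f p) * (∑ q ∈ g.support, q * g q) := by
  change (cycProd f g).sum (fun r n => r * n) = _
  rw [sum_mul_cycProd, Finset.sum_mul_sum]
  refine Finset.sum_congr rfl fun p _ => Finset.sum_congr rfl fun q _ => ?_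
  rw [mul_left_comm (Nat.lcm p q), Nat.mul_div_cancel' (Nat.lcm_dvd_mul p q)]
  ring
end

section
/- Let w ≥ 1 and let x, b : ℕ →₀ ℕ have supports containing only positive integers, with x ≠ 0 and x^{⊙w} = b (w-th cycle power). Then x.support ⊆ b.support; in particular x.support.card ≤ b.support.card. -/
theorem lcm_mem_support_cycProd {f g : ℕ →₀ ℕ} {p q : ℕ} (hp : p ∈ f.support)
    (hq : q ∈ g.support) (hp0 : 0 < p) (hq0 : 0 < q) :
    Nat.lcm p q ∈ (cycProd f g).support := by
  have hle : Finsupp.single (Nat.lcm p q) (f p * g q * (p * q / Nat.lcm p q)) ≤ cycProd f g :=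
    (Finset.single_le_sum (f := fun q => Finsupp.single (Nat.lcm p q)
      (f p * g q * (p * q / Nat.lcm p q))) (fun _ _ => zero_le) hq).trans
    (Finset.single_le_sum (f := fun p => ∑ q ∈ g.support, Finsupp.single (Nat.lcm p q)
      (f p * g q * (p * q / Nat.lcm p q))) (fun _ _ => zero_le) hp)
  have hdiv : 0 < p * q / Nat.lcm p q :=
    Nat.div_pos (Nat.le_of_dvd (Nat.mul_pos hp0 hq0) (Nat.lcm_dvd_mul p q))
      (Nat.lcm_pos hp0 hq0)
  have hpos : 0 < f p * g q * (p * q / Nat.lcm p q) :=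
    Nat.mul_pos (Nat.mul_pos (Nat.pos_of_ne_zero (Finsupp.mem_support_iff.mp hp))
      (Nat.pos_of_ne_zero (Finsupp.mem_support_iff.mp hq))) hdiv
  have hval := hle (Nat.lcm p q)
  rw [Finsupp.single_eq_same] at hval
  exact Finsupp.mem_support_iff.mpr (hpos.trans_le hval).ne'

theorem mem_support_cycPow_succ {f : ℕ →₀ ℕ} {p : ℕ} (hp : p ∈ f.support) (hp0 : 0 < p)
    (k : ℕ) : p ∈ (cycPow f (k + 1)).support := by
  induction k with
  | zero =>
    have h : 1 ∈ (cycPow f 0).support := by simp [cycPow]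
    simpa [cycPow] using lcm_mem_support_cycProd hp h hp0 one_pos
  | succ k ih =>
    have h := lcm_mem_support_cycProd hp ih hp0 hp0
    rwa [Nat.lcm_self] at h

theorem stmt_9 (w : ℕ) (hw : 1 ≤ w) (x b : ℕ →₀ ℕ)
    (hx : ∀ p ∈ x.support, 0 < p) (hb : ∀ p ∈ b.support, 0 < p)
    (hx0 : x ≠ 0) (heq : cycPow x w = b) :
    x.support ⊆ b.support ∧ x.support.card ≤ b.support.card := by
  have hsub : x.support ⊆ b.support := by
    intro p hp
    obtain ⟨k, rfl⟩ := Nat.exists_eq_add_of_le' hw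
    exact heq ▸ mem_support_cycPow_succ hp (hx p hp) k
  exact ⟨hsub, Finset.card_le_card hsub⟩
end

section
/- Let w ≥ 2 and let x, b : ℕ →₀ ℕ have supports containing only positive integers, with x ≠ 0 and x^{⊙w} = b. Then (a) the least element of x.support equals the least element of b.support, and (b) if x.support has at least two elements, then the second-smallest element of x.support equals the second-smallest element of b.support. -/
/-- The least element of the support of `f` (`0` if the support is empty). -/
noncomputable def minElt (f : ℕ →₀ ℕ) : ℕ := sInf {a : ℕ | a ∈ f.support}

/-- The second-smallest element of the support of `f`. -/
noncomputable def secondElt (f : ℕ →₀ ℕ) : ℕ :=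
  sInf {a : ℕ | a ∈ f.support ∧ a ≠ minElt f}

theorem mem_support_cycProd {f g : ℕ →₀ ℕ} (hf : ∀ p ∈ f.support, 0 < p)
    (hg : ∀ q ∈ g.support, 0 < q) (r : ℕ) :
    r ∈ (cycProd f g).support ↔ ∃ p ∈ f.support, ∃ q ∈ g.support, Nat.lcm p q = r := by
  have coeff_ne_zero : ∀ p ∈ f.support, ∀ q ∈ g.support,
      f p * g q * (p * q / Nat.lcm p q) ≠ 0 := by
    intro p hp q hq
    have hdiv : 0 < p * q / Nat.lcm p q :=
      Nat.div_pos (Nat.le_of_dvd (Nat.mul_pos (hf p hp) (hg q hq)) (Nat.lcm_dvd_mul p q))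
        (Nat.lcm_pos (hf p hp) (hg q hq))
    exact mul_ne_zero (mul_ne_zero (Finsupp.mem_support_iff.mp hp)
      (Finsupp.mem_support_iff.mp hq)) hdiv.ne'
  simp only [cycProd, Finsupp.mem_support_iff (f := Finset.sum _ _), Finsupp.finsetSum_apply,
    ne_eq, Finset.sum_eq_zero_iff, not_forall, exists_prop, Finsupp.single_apply, ite_eq_right_iff]
  constructor
  · rintro ⟨p, hp, q, hq, h, -⟩
    exact ⟨p, hp, q, hq, h⟩
  · rintro ⟨p, hp, q, hq, h⟩
    exact ⟨p, hp, q, hq, h, coeff_ne_zero p hp q hq⟩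

theorem pos_of_mem_support_cycPow {x : ℕ →₀ ℕ} (hx : ∀ p ∈ x.support, 0 < p) (k : ℕ) :
    ∀ r ∈ (cycPow x k).support, 0 < r := by
  induction k with
  | zero =>
    intro r hr
    simp [cycPow] at hr
    omega
  | succ k ih =>
    intro r hr
    obtain ⟨p, hp, q, hq, rfl⟩ := (mem_support_cycProd hx ih r).mp hr
    exact Nat.lcm_pos (hx p hp) (ih q hq)

theorem mem_support_cycPow_succ_s10 {x : ℕ →₀ ℕ} (hx : ∀ p ∈ x.support, 0 < p) (k r : ℕ) :
    r ∈ (cycPow x (k + 1)).support ↔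
      ∃ p ∈ x.support, ∃ q ∈ (cycPow x k).support, Nat.lcm p q = r :=
  mem_support_cycProd hx (pos_of_mem_support_cycPow hx k) r

theorem mem_support_cycPow_one {x : ℕ →₀ ℕ} (hx : ∀ p ∈ x.support, 0 < p) (r : ℕ) :
    r ∈ (cycPow x 1).support ↔ r ∈ x.support := by
  rw [mem_support_cycPow_succ_s10 hx]
  simp [cycPow]

theorem support_subset_support_cycPow {x : ℕ →₀ ℕ} (hx : ∀ p ∈ x.support, 0 < p) (k : ℕ) :
    x.support ⊆ (cycPow x (k + 1)).support := by
  induction k with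
  | zero => exact fun p hp => (mem_support_cycPow_one hx p).mpr hp
  | succ k ih =>
    exact fun p hp => (mem_support_cycPow_succ_s10 hx _ p).mpr ⟨p, hp, p, ih hp, Nat.lcm_self p⟩

/-- Every cycle length of a positive power other than `a` is divisible by a cycle length of the
base other than `a`. -/
theorem exists_dvd_of_mem_support_cycPow {x : ℕ →₀ ℕ} (hx : ∀ p ∈ x.support, 0 < p) (a k : ℕ) :
    ∀ r ∈ (cycPow x (k + 1)).support, r ≠ a → ∃ q ∈ x.support, q ≠ a ∧ q ∣ r := by
  induction k with
  | zero => exact fun r hr hra => ⟨r, (mem_support_cycPow_one hx r).mp hr, hra, dvd_rfl⟩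
  | succ k ih =>
    intro r hr hra
    obtain ⟨p, hp, s, hs, rfl⟩ := (mem_support_cycPow_succ_s10 hx _ r).mp hr
    by_cases hpa : p = a
    · have hsa : s ≠ a := by
        rintro rfl
        exact hra (by rw [hpa, Nat.lcm_self])
      obtain ⟨q, hq, hqa, hqs⟩ := ih s hs hsa
      exact ⟨q, hq, hqa, hqs.trans (Nat.dvd_lcm_right p s)⟩
    · exact ⟨p, hp, hpa, Nat.dvd_lcm_left p s⟩

theorem Nat.sInf_eq_sInf_of_subset_of_forall_exists_le {s t : Set ℕ} (hs : s.Nonempty)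
    (hst : s ⊆ t) (h : ∀ b ∈ t, ∃ a ∈ s, a ≤ b) : sInf s = sInf t := by
  obtain ⟨a, ha, hle⟩ := h _ (Nat.sInf_mem (hs.mono hst))
  exact le_antisymm ((Nat.sInf_le ha).trans hle) (Nat.sInf_le (hst (Nat.sInf_mem hs)))

theorem stmt_10 (w : ℕ) (hw : 2 ≤ w) (x b : ℕ →₀ ℕ)
    (hx : ∀ p ∈ x.support, 0 < p) (hb : ∀ p ∈ b.support, 0 < p)
    (hx0 : x ≠ 0) (heq : cycPow x w = b) :
    minElt x = minElt b ∧ (2 ≤ x.support.card → secondElt x = secondElt b) := by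
  subst heq
  obtain ⟨k, rfl⟩ : ∃ k, w = k + 1 := ⟨w - 1, by omega⟩
  have hsub := support_subset_support_cycPow hx k
  have hmin : minElt x = minElt (cycPow x (k + 1)) := by
    refine Nat.sInf_eq_sInf_of_subset_of_forall_exists_le
      (Finsupp.support_nonempty_iff.mpr hx0) (fun p hp => hsub hp) fun r hr => ?_
    obtain ⟨q, hq, -, hqr⟩ := exists_dvd_of_mem_support_cycPow hx 0 k r hr (hb r hr).ne'
    exact ⟨q, hq, Nat.le_of_dvd (hb r hr) hqr⟩
  refine ⟨hmin, fun hcard => ?_⟩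
  unfold secondElt
  rw [← hmin]
  refine Nat.sInf_eq_sInf_of_subset_of_forall_exists_le
    (Finset.exists_mem_ne hcard (minElt x)) (fun p hp => ⟨hsub hp.1, hp.2⟩) ?_
  rintro r ⟨hr, hrm⟩
  obtain ⟨q, hq, hqm, hqr⟩ := exists_dvd_of_mem_support_cycPow hx (minElt x) k r hr hrm
  exact ⟨q, ⟨hq, hqm⟩, Nat.le_of_dvd (hb r hr) hqr⟩
end

section
/- Let w ≥ 2 and let x, b : ℕ →₀ ℕ have supports containing only positive integers, with x ≠ 0 and x^{⊙w} = b. Let o₁ be the least element of b.support, let n₁ = x o₁ and s₁ = b o₁. Then o₁^(w−1) * n₁^w = s₁ (equivalently, n₁ is the w-th root of s₁ / o₁^{w−1}). -/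
theorem le_lcm_of_forall_lt {f g : ℕ →₀ ℕ} {m p q : ℕ} (hm : 0 < m)
    (hf : ∀ r < m, f r = 0) (hg : ∀ r < m, g r = 0)
    (hp : p ∈ f.support) (hq : q ∈ g.support) :
    m ≤ p ∧ m ≤ q ∧ p ≤ Nat.lcm p q ∧ q ≤ Nat.lcm p q := by
  have hmp : m ≤ p := not_lt.mp fun h => Finsupp.mem_support_iff.mp hp (hf p h)
  have hmq : m ≤ q := not_lt.mp fun h => Finsupp.mem_support_iff.mp hq (hg q h)
  have hl : 0 < Nat.lcm p q := Nat.lcm_pos (hm.trans_le hmp) (hm.trans_le hmq)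
  exact ⟨hmp, hmq, Nat.le_of_dvd hl (Nat.dvd_lcm_left p q), Nat.le_of_dvd hl (Nat.dvd_lcm_right p q)⟩

theorem cycProd_apply (f g : ℕ →₀ ℕ) (r : ℕ) :
    cycProd f g r = ∑ p ∈ f.support, ∑ q ∈ g.support,
      if Nat.lcm p q = r then f p * g q * (p * q / Nat.lcm p q) else 0 := by
  simp only [cycProd, Finsupp.finsetSum_apply, Finsupp.single_apply]

/-- The product of two unions of cycles of length at least `m` has no cycle shorter than `m`. -/
theorem cycProd_apply_eq_zero {f g : ℕ →₀ ℕ} {m r : ℕ} (hm : 0 < m)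
    (hf : ∀ r < m, f r = 0) (hg : ∀ r < m, g r = 0) (hr : r < m) : cycProd f g r = 0 := by
  rw [cycProd_apply]
  refine Finset.sum_eq_zero fun p hp => Finset.sum_eq_zero fun q hq => if_neg ?_
  have := le_lcm_of_forall_lt hm hf hg hp hq
  omega

/-- In the product of two unions of cycles of length at least `m`, the cycles of length `m` come
only from pairs of cycles of length `m`. -/
theorem cycProd_apply_min {f g : ℕ →₀ ℕ} {m : ℕ} (hm : 0 < m)
    (hf : ∀ r < m, f r = 0) (hg : ∀ r < m, g r = 0) : cycProd f g m = f m * g m * m := by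
  rw [cycProd_apply, Finset.sum_eq_single m, Finset.sum_eq_single m]
  · simp [Nat.lcm_self, Nat.mul_div_cancel _ hm]
  · intro q hq hqm
    rw [ite_eq_right_iff]
    intro hl
    have hmq : m ≤ q := not_lt.mp fun h => Finsupp.mem_support_iff.mp hq (hg q h)
    have := Nat.le_of_dvd hm (hl ▸ Nat.dvd_lcm_right m q)
    omega
  · intro h
    simp [Finsupp.notMem_support_iff.mp h]
  · intro p hp hpm
    refine Finset.sum_eq_zero fun q hq => if_neg ?_
    have := le_lcm_of_forall_lt hm hf hg hp hq
    omega
  · intro h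
    simp [Finsupp.notMem_support_iff.mp h]

theorem cycProd_one (f : ℕ →₀ ℕ) (hf : ∀ p ∈ f.support, 0 < p) :
    cycProd f (Finsupp.single 1 1) = f := by
  conv_rhs => rw [← Finsupp.sum_single f]
  refine Finset.sum_congr rfl fun p hp => ?_
  rw [Finsupp.support_single _ one_ne_zero, Finset.sum_singleton, Finsupp.single_eq_same,
    Nat.lcm_one_right, mul_one, mul_one, Nat.div_self (hf p hp), mul_one]

theorem cycPow_succ_apply_min {x : ℕ →₀ ℕ} {m : ℕ} (hx : ∀ p ∈ x.support, 0 < p) (hm : 0 < m)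
    (hlt : ∀ r < m, x r = 0) (k : ℕ) :
    (∀ r < m, cycPow x (k + 1) r = 0) ∧ cycPow x (k + 1) m = m ^ k * x m ^ (k + 1) := by
  induction k with
  | zero =>
    rw [cycPow, cycPow, cycProd_one x hx]
    exact ⟨hlt, by simp⟩
  | succ k ih =>
    rw [cycPow]
    refine ⟨fun r hr => cycProd_apply_eq_zero hm hlt ih.1 hr, ?_⟩
    rw [cycProd_apply_min hm hlt ih.1, ih.2]
    ring

theorem minElt_mem_support {f : ℕ →₀ ℕ} (hf : f ≠ 0) : minElt f ∈ f.support :=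
  Nat.sInf_mem (s := {a | a ∈ f.support}) (Finsupp.support_nonempty_iff.mpr hf)

theorem apply_eq_zero_of_lt_minElt {f : ℕ →₀ ℕ} {r : ℕ} (hr : r < minElt f) : f r = 0 :=
  Finsupp.notMem_support_iff.mp (Nat.notMem_of_lt_sInf hr)

theorem minElt_eq_of_forall_lt {f : ℕ →₀ ℕ} {m : ℕ} (hm : f m ≠ 0) (hlt : ∀ r < m, f r = 0) :
    minElt f = m := by
  refine le_antisymm (Nat.sInf_le (Finsupp.mem_support_iff.mpr hm)) (not_lt.mp fun h => ?_)
  have hf : f ≠ 0 := fun h0 => hm (by simp [h0])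
  exact Finsupp.mem_support_iff.mp (minElt_mem_support hf) (hlt _ h)

theorem stmt_11 (w : ℕ) (hw : 2 ≤ w) (x b : ℕ →₀ ℕ)
    (hx : ∀ p ∈ x.support, 0 < p) (hb : ∀ p ∈ b.support, 0 < p)
    (hx0 : x ≠ 0) (heq : cycPow x w = b) :
    minElt b ^ (w - 1) * (x (minElt b)) ^ w = b (minElt b) := by
  obtain ⟨k, rfl⟩ : ∃ k, w = k + 1 := ⟨w - 1, by omega⟩
  have hmem := minElt_mem_support hx0
  have hm := hx _ hmem
  obtain ⟨hlt, hval⟩ :=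
    cycPow_succ_apply_min hx hm (fun r hr => apply_eq_zero_of_lt_minElt hr) k
  have hne : cycPow x (k + 1) (minElt x) ≠ 0 := by
    rw [hval]
    exact mul_ne_zero (pow_ne_zero _ hm.ne') (pow_ne_zero _ (Finsupp.mem_support_iff.mp hmem))
  rw [← heq, minElt_eq_of_forall_lt hne hlt, hval, Nat.add_sub_cancel]
end

section
/- Let w ≥ 2 and let x, b : ℕ →₀ ℕ have supports containing only positive integers, with x.support having at least two elements and x^{⊙w} = b. Let o₁ < o₂ be the two smallest elements of b.support, and set n₁ = x o₁, n₂ = x o₂, s₁ = b o₁, s₂ = b o₂. If o₁ divides o₂ (i.e. lcm(o₁,o₂) = o₂), then (o₁ * n₁ + o₂ * n₂)^w = o₂ * s₂ + o₁ * s₁ (equivalently, n₂ = (ʷ√(o₂s₂ + o₁s₁) − ʷ√(o₁s₁)) / o₂). -/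
/-- The number of points of `f` lying on a cycle whose length divides `n`, i.e. the number of
fixed points of the `n`-th iterate. -/
noncomputable def fixedCount (n : ℕ) : (ℕ →₀ ℕ) →+ ℕ :=
  Finsupp.liftAddHom fun p => if p ∣ n then AddMonoidHom.mulLeft p else 0

theorem fixedCount_single (n p c : ℕ) :
    fixedCount n (Finsupp.single p c) = if p ∣ n then p * c else 0 := by
  rw [fixedCount, Finsupp.liftAddHom_apply_single]
  split_ifs <;> simp

theorem fixedCount_eq_sum (n : ℕ) (f : ℕ →₀ ℕ) :
    fixedCount n f = ∑ p ∈ f.support, if p ∣ n then p * f p else 0 := by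
  rw [fixedCount, Finsupp.liftAddHom_apply, Finsupp.sum]
  refine Finset.sum_congr rfl fun p _ => ?_
  split_ifs <;> simp

theorem lcm_mul_mul_div_lcm (p q c d : ℕ) :
    Nat.lcm p q * (c * d * (p * q / Nat.lcm p q)) = p * c * (q * d) := by
  have h : Nat.lcm p q * (p * q / Nat.lcm p q) = p * q :=
    Nat.mul_div_cancel' (Nat.lcm_dvd_mul p q)
  calc _ = c * d * (Nat.lcm p q * (p * q / Nat.lcm p q)) := by ring
    _ = _ := by rw [h]; ring

theorem fixedCount_cycProd (n : ℕ) (f g : ℕ →₀ ℕ) :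
    fixedCount n (cycProd f g) = fixedCount n f * fixedCount n g := by
  rw [fixedCount_eq_sum n f, fixedCount_eq_sum n g, Finset.sum_mul_sum, cycProd, map_sum]
  refine Finset.sum_congr rfl fun p _ => ?_
  rw [map_sum]
  refine Finset.sum_congr rfl fun q _ => ?_
  rw [fixedCount_single, lcm_mul_mul_div_lcm, ite_zero_mul_ite_zero]
  simp only [Nat.lcm_dvd_iff]

theorem fixedCount_cycPow (n : ℕ) (f : ℕ →₀ ℕ) (k : ℕ) :
    fixedCount n (cycPow f k) = fixedCount n f ^ k := by
  induction k with
  | zero => simp [cycPow, fixedCount_single]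
  | succ k ih => rw [cycPow, fixedCount_cycProd, ih, pow_succ']

theorem support_subset_support_cycPow_s12 {f : ℕ →₀ ℕ} (hf : ∀ p ∈ f.support, 0 < p) {k : ℕ}
    (hk : k ≠ 0) : f.support ⊆ (cycPow f k).support := by
  intro p hp
  have hp0 := hf p hp
  induction k, Nat.one_le_iff_ne_zero.2 hk using Nat.le_induction with
  | base =>
    simpa [cycPow] using lcm_mem_support_cycProd (g := Finsupp.single 1 1) (q := 1) hp
      (by simp) hp0 one_pos
  | succ k hk1 ih =>
    simpa [cycPow] using lcm_mem_support_cycProd hp (ih (by omega)) hp0 hp0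

/-- If `a ∣ b`, and `a`, `b` are the only possible cycle lengths of `f` dividing `b`, then
`fixedCount b f` only involves these two lengths. -/
theorem fixedCount_eq_pair {f : ℕ →₀ ℕ} {a b : ℕ} (hab : a ≠ b) (hdvd : a ∣ b)
    (h : ∀ p ∈ f.support, p ∣ b → p = a ∨ p = b) :
    fixedCount b f = a * f a + b * f b := by
  have hpair : ∑ p ∈ ({a, b} : Finset ℕ), (if p ∣ b then p * f p else 0) =
      a * f a + b * f b := by
    rw [Finset.sum_pair hab, if_pos hdvd, if_pos dvd_rfl]
  rw [fixedCount_eq_sum, ← hpair, ← Finset.sum_filter, ← Finset.sum_filter]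
  refine Finset.sum_subset_zero_on_sdiff (fun p hp => ?_) (fun p hp => ?_) fun _ _ => rfl
  · rw [Finset.mem_filter] at hp ⊢
    exact ⟨by simpa using h p hp.1 hp.2, hp.2⟩
  · simp only [Finset.mem_sdiff, Finset.mem_filter, Finsupp.mem_support_iff] at hp
    have : f p = 0 := by tauto
    simp [this]

theorem secondElt_mem {f : ℕ →₀ ℕ} (hf : 2 ≤ f.support.card) :
    secondElt f ∈ f.support ∧ secondElt f ≠ minElt f := by
  obtain ⟨a, ha, hne⟩ := Finset.exists_mem_ne (by omega : 1 < f.support.card) (minElt f)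
  exact Nat.sInf_mem (s := {a : ℕ | a ∈ f.support ∧ a ≠ minElt f}) ⟨a, ha, hne⟩

theorem eq_minElt_or_eq_secondElt {f : ℕ →₀ ℕ} {p : ℕ} (hp : p ∈ f.support)
    (hle : p ≤ secondElt f) : p = minElt f ∨ p = secondElt f := by
  by_cases h : p = minElt f
  · exact Or.inl h
  · exact Or.inr (hle.antisymm (Nat.sInf_le ⟨hp, h⟩))

theorem stmt_12 (w : ℕ) (hw : 2 ≤ w) (x b : ℕ →₀ ℕ)
    (hx : ∀ p ∈ x.support, 0 < p) (hb : ∀ p ∈ b.support, 0 < p)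
    (hcard : 2 ≤ x.support.card) (heq : cycPow x w = b)
    (hdvd : Nat.lcm (minElt b) (secondElt b) = secondElt b) :
    (minElt b * x (minElt b) + secondElt b * x (secondElt b)) ^ w =
      secondElt b * b (secondElt b) + minElt b * b (minElt b) := by
  have hsub : x.support ⊆ b.support :=
    heq ▸ support_subset_support_cycPow_s12 hx (by omega : w ≠ 0)
  obtain ⟨hmem, hne⟩ := secondElt_mem (hcard.trans (Finset.card_le_card hsub))
  have hdvd' : minElt b ∣ secondElt b := Nat.lcm_eq_right_iff_dvd.1 hdvd
  have hpair : ∀ p ∈ b.support, p ∣ secondElt b → p = minElt b ∨ p = secondElt b :=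
    fun p hp hpd => eq_minElt_or_eq_secondElt hp (Nat.le_of_dvd (hb _ hmem) hpd)
  rw [← fixedCount_eq_pair hne.symm hdvd' fun p hp => hpair p (hsub hp),
    ← fixedCount_cycPow, heq, fixedCount_eq_pair hne.symm hdvd' hpair, add_comm]
end

section
/- Let w ≥ 2 and let x, b : ℕ →₀ ℕ have supports containing only positive integers, with x.support having at least two elements and x^{⊙w} = b. Let o₁ < o₂ be the two smallest elements of b.support, and set n₂ = x o₂, s₂ = b o₂. If o₁ does not divide o₂ (i.e. lcm(o₁,o₂) ≠ o₂), then o₂^(w−1) * n₂^w = s₂. -/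
/-- The number of points of `f` whose cycle length divides `m`, as an additive map in `f`. -/
noncomputable def periodicCount (m : ℕ) : (ℕ →₀ ℕ) →+ ℕ :=
  Finsupp.liftAddHom fun p => if p ∣ m then AddMonoidHom.mulLeft p else 0

theorem periodicCount_single (m p n : ℕ) :
    periodicCount m (Finsupp.single p n) = if p ∣ m then p * n else 0 := by
  simp only [periodicCount, Finsupp.liftAddHom_apply_single]
  split_ifs <;> simp

theorem periodicCount_apply (m : ℕ) (f : ℕ →₀ ℕ) :
    periodicCount m f = ∑ p ∈ f.support, if p ∣ m then p * f p else 0 := by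
  conv_lhs => rw [← f.sum_single, Finsupp.sum, map_sum]
  simp only [periodicCount_single]

theorem periodicCount_cycProd (m : ℕ) (f g : ℕ →₀ ℕ) :
    periodicCount m (cycProd f g) = periodicCount m f * periodicCount m g := by
  rw [periodicCount_apply m f, periodicCount_apply m g, Finset.sum_mul_sum, cycProd]
  simp only [map_sum, periodicCount_single, Nat.lcm_dvd_iff]
  refine Finset.sum_congr rfl fun p _ => Finset.sum_congr rfl fun q _ => ?_
  have h : Nat.lcm p q * (p * q / Nat.lcm p q) = p * q :=
    Nat.mul_div_cancel' (Nat.lcm_dvd_mul p q)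
  by_cases hp : p ∣ m <;> by_cases hq : q ∣ m <;> simp only [hp, hq, and_self, and_true,
    and_false, if_true, if_false, mul_zero, zero_mul]
  linear_combination (f p * g q) * h

theorem periodicCount_cycPow (m : ℕ) (f : ℕ →₀ ℕ) (k : ℕ) :
    periodicCount m (cycPow f k) = periodicCount m f ^ k := by
  induction k with
  | zero => simp [cycPow, periodicCount_single]
  | succ k ih => rw [cycPow, periodicCount_cycProd, ih, pow_succ']

theorem periodicCount_eq_of_forall_dvd {m : ℕ} {f : ℕ →₀ ℕ}
    (h : ∀ p ∈ f.support, p ∣ m → p = m) : periodicCount m f = m * f m := by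
  rw [periodicCount_apply, Finset.sum_eq_single m]
  · simp
  · exact fun p hp hpm => if_neg fun hd => hpm (h p hp hd)
  · intro hm
    simp [Finsupp.notMem_support_iff.mp hm]

theorem mem_support_cycPow {f : ℕ →₀ ℕ} {p k : ℕ} (hp : p ∈ f.support) (hp0 : 0 < p)
    (hk : k ≠ 0) : p ∈ (cycPow f k).support := by
  obtain ⟨k, rfl⟩ := Nat.exists_eq_succ_of_ne_zero hk
  clear hk
  induction k with
  | zero =>
    simpa [cycPow] using
      lcm_mem_support_cycProd (g := Finsupp.single 1 1) (q := 1) hp (by simp) hp0 one_pos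
  | succ k ih => simpa [cycPow] using lcm_mem_support_cycProd hp ih hp0 hp0

theorem eq_secondElt_of_dvd {f : ℕ →₀ ℕ} {p : ℕ} (h0 : secondElt f ≠ 0)
    (hndvd : ¬ minElt f ∣ secondElt f) (hp : p ∈ f.support) (hd : p ∣ secondElt f) :
    p = secondElt f :=
  le_antisymm (Nat.le_of_dvd (Nat.pos_of_ne_zero h0) hd)
    (Nat.sInf_le ⟨hp, fun h => hndvd (h ▸ hd)⟩)


theorem stmt_13 (w : ℕ) (hw : 2 ≤ w) (x b : ℕ →₀ ℕ)
    (hx : ∀ p ∈ x.support, 0 < p) (hb : ∀ p ∈ b.support, 0 < p)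
    (hcard : 2 ≤ x.support.card) (heq : cycPow x w = b)
    (hndvd : Nat.lcm (minElt b) (secondElt b) ≠ secondElt b) :
    secondElt b ^ (w - 1) * (x (secondElt b)) ^ w = b (secondElt b) := by
  subst heq
  have h0 : secondElt (cycPow x w) ≠ 0 := fun h => hndvd (by rw [h, Nat.lcm_zero_right])
  have hnd : ¬ minElt (cycPow x w) ∣ secondElt (cycPow x w) :=
    fun h => hndvd (Nat.lcm_eq_right_iff_dvd.mpr h)
  have hw0 : w ≠ 0 := by omega
  have h := periodicCount_cycPow (secondElt (cycPow x w)) x w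
  rw [periodicCount_eq_of_forall_dvd fun p hp => eq_secondElt_of_dvd h0 hnd hp,
    periodicCount_eq_of_forall_dvd fun p hp =>
      eq_secondElt_of_dvd h0 hnd (mem_support_cycPow hp (hx p hp) hw0),
    mul_pow, ← mul_pow_sub_one hw0, mul_assoc] at h
  exact (Nat.eq_of_mul_eq_mul_left (Nat.pos_of_ne_zero h0) h).symm
end

section
/- Let w ≥ 2 and let x, b : ℕ →₀ ℕ have supports containing only positive integers, with x^{⊙w} = b. Write x.support = {p₁ < p₂ < … < p_l}, set n_j = x p_j, and fix i with 2 ≤ i < l. If lcm(p₁, …, p_{i+1}) = p_{i+1} (i.e. every p_j with j ≤ i divides p_{i+1}), then (∑_{j=1}^{i+1} p_j * n_j)^w = p_{i+1} * (b p_{i+1}) + Q*, where Q* = ∑ over all k : {1,…,i} → ℕ with ∑_j k_j = w and lcm{ p_j : k_j ≠ 0 } ≠ p_{i+1} of (Nat.multinomial coefficient of k) * ∏_{j=1}^{i} (p_j * n_j)^(k_j). (Equivalently, n_{i+1} = (ʷ√(p_{i+1}·b(p_{i+1}) + Q*) − ∑_{j=1}^{i} p_j n_j) / p_{i+1}.)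 -/
/-- `pElt x j` is the `(j+1)`-st smallest element of the support of `x`
(so `pElt x 0 = p₁`, `pElt x 1 = p₂`, …, in the notation `x.support = {p₁ < p₂ < … < p_l}`). -/
noncomputable def pElt (x : ℕ →₀ ℕ) (j : ℕ) : ℕ := (x.support.sort (· ≤ ·)).getD j 0

theorem sum_divisors_mul_single {r : ℕ} (hr : r ≠ 0) (m c : ℕ) :
    ∑ d ∈ r.divisors, d * Finsupp.single m c d = if m ∣ r then m * c else 0 := by
  simp [Finsupp.single_apply, hr]

theorem sum_divisors_mul_eq_sum_support {r : ℕ} (hr : r ≠ 0) (f : ℕ →₀ ℕ) :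
    ∑ d ∈ r.divisors, d * f d = ∑ p ∈ f.support, if p ∣ r then p * f p else 0 := by
  conv_lhs => rw [← f.sum_single, Finsupp.sum]
  simp_rw [Finsupp.finsetSum_apply, Finset.mul_sum]
  rw [Finset.sum_comm]
  simp_rw [sum_divisors_mul_single hr]

theorem sum_divisors_mul_cycProd {r : ℕ} (hr : r ≠ 0) (f g : ℕ →₀ ℕ) :
    ∑ d ∈ r.divisors, d * cycProd f g d =
      (∑ d ∈ r.divisors, d * f d) * ∑ d ∈ r.divisors, d * g d := by
  rw [sum_divisors_mul_eq_sum_support hr f, sum_divisors_mul_eq_sum_support hr g,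
    Finset.sum_mul_sum, cycProd]
  simp_rw [Finsupp.finsetSum_apply, Finset.mul_sum]
  rw [Finset.sum_comm]
  refine Finset.sum_congr rfl fun p _ => ?_
  rw [Finset.sum_comm]
  refine Finset.sum_congr rfl fun q _ => ?_
  rw [sum_divisors_mul_single hr, mul_left_comm,
    Nat.mul_div_cancel' (Nat.lcm_dvd_mul p q)]
  by_cases hp : p ∣ r <;> by_cases hq : q ∣ r <;> simp [Nat.lcm_dvd_iff, hp, hq]
  ring

theorem sum_divisors_mul_cycPow {r : ℕ} (hr : r ≠ 0) (x : ℕ →₀ ℕ) (w : ℕ) :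
    ∑ d ∈ r.divisors, d * cycPow x w d = (∑ d ∈ r.divisors, d * x d) ^ w := by
  induction w with
  | zero => simp [cycPow, sum_divisors_mul_single hr]
  | succ w ih => rw [cycPow, sum_divisors_mul_cycProd hr, ih, pow_succ']

/-- The multinomial expansion of the sum of the `a j` with `p j ∣ r`. -/
theorem sum_multinomial_filter_lcm_dvd {n : ℕ} (w r : ℕ) (p a : Fin n → ℕ) :
    ∑ k ∈ (Finset.Nat.antidiagonalTuple n w).filter
        (fun k => (Finset.univ.filter (fun j => k j ≠ 0)).lcm p ∣ r),
      Nat.multinomial Finset.univ k * ∏ j, a j ^ k j =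
      (∑ j, if p j ∣ r then a j else 0) ^ w := by
  have h : Finset.piAntidiag Finset.univ w = Finset.Nat.antidiagonalTuple n w := by
    ext k
    simp [Finset.Nat.mem_antidiagonalTuple]
  rw [Finset.sum_pow_eq_sum_piAntidiag, h, Finset.sum_filter]
  refine Finset.sum_congr rfl fun k _ => ?_
  split_ifs with hk <;> rw [Finset.lcm_dvd_iff] at hk
  · rw [Nat.cast_id]
    congr 1
    refine Finset.prod_congr rfl fun j _ => ?_
    by_cases hj : k j = 0
    · simp [hj]
    · rw [if_pos (hk j (by simpa using hj))]
  · push Not at hk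
    obtain ⟨j, hj, hjr⟩ := hk
    rw [Finset.prod_eq_zero (Finset.mem_univ j), mul_zero]
    · rw [if_neg hjr, zero_pow (by simpa using hj)]

/-- A function on the divisors of `P` other than `P` is determined by its divisor sums. -/
theorem eq_of_sum_divisors_eq {P : ℕ} {F G : ℕ → ℕ}
    (h : ∀ r ∈ P.properDivisors, ∑ d ∈ r.divisors, F d = ∑ d ∈ r.divisors, G d) :
    ∀ r ∈ P.properDivisors, F r = G r := by
  intro r
  induction r using Nat.strong_induction_on with
  | _ r ih =>
    intro hr
    have hrP := h r hr
    rw [Nat.mem_properDivisors] at hr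
    have hr0 : r ≠ 0 := ne_zero_of_dvd_ne_zero (by omega) hr.1
    rw [← Nat.cons_self_properDivisors hr0, Finset.sum_cons, Finset.sum_cons] at hrP
    have : ∑ d ∈ r.properDivisors, F d = ∑ d ∈ r.properDivisors, G d :=
      Finset.sum_congr rfl fun d hd => by
        rw [Nat.mem_properDivisors] at hd
        exact ih d hd.2 (Nat.mem_properDivisors.2 ⟨hd.1.trans hr.1, hd.2.trans hr.2⟩)
    omega

theorem pElt_eq_orderEmbOfFin (x : ℕ →₀ ℕ) (j : Fin x.support.card) :
    pElt x j = x.support.orderEmbOfFin rfl j := by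
  simp [pElt, Finset.orderEmbOfFin_apply]

theorem pElt_lt_pElt (x : ℕ →₀ ℕ) {j k : ℕ} (hjk : j < k) (hk : k < x.support.card) :
    pElt x j < pElt x k := by
  rw [pElt_eq_orderEmbOfFin x ⟨j, hjk.trans hk⟩, pElt_eq_orderEmbOfFin x ⟨k, hk⟩]
  exact (x.support.orderEmbOfFin rfl).strictMono hjk

theorem pElt_mem_support (x : ℕ →₀ ℕ) {j : ℕ} (hj : j < x.support.card) :
    pElt x j ∈ x.support := by
  rw [pElt_eq_orderEmbOfFin x ⟨j, hj⟩]
  exact Finset.orderEmbOfFin_mem _ _ _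

theorem sum_support_eq_sum_pElt (x : ℕ →₀ ℕ) (f : ℕ → ℕ) :
    ∑ p ∈ x.support, f p = ∑ j ∈ Finset.range x.support.card, f (pElt x j) := by
  conv_lhs => rw [← Finset.map_orderEmbOfFin_univ x.support rfl]
  rw [Finset.sum_map, Finset.sum_range]
  simp [pElt_eq_orderEmbOfFin]

/-- Only the elements of the support up to `pElt x i` can divide a number `r ≤ pElt x i`. -/
theorem sum_divisors_mul_eq_sum_pElt (x : ℕ →₀ ℕ) {i r : ℕ} (hi : i < x.support.card)
    (hr : r ≠ 0) (hri : r ≤ pElt x i) :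
    ∑ d ∈ r.divisors, d * x d =
      ∑ j ∈ Finset.range (i + 1), if pElt x j ∣ r then pElt x j * x (pElt x j) else 0 := by
  rw [sum_divisors_mul_eq_sum_support hr, sum_support_eq_sum_pElt]
  symm
  refine Finset.sum_subset (by simpa using hi) fun j hj hji => if_neg fun hdvd => ?_
  rw [Finset.mem_range] at hj hji
  have := Nat.le_of_dvd (Nat.pos_of_ne_zero hr) hdvd
  have := pElt_lt_pElt x (show i < j by omega) hj
  omega

theorem stmt_15 (w : ℕ) (hw : 2 ≤ w) (x b : ℕ →₀ ℕ)
    (hx : ∀ p ∈ x.support, 0 < p) (hb : ∀ p ∈ b.support, 0 < p)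
    (heq : cycPow x w = b)
    -- `i` is the paper's index: `2 ≤ i < l`; with the `0`-based `pElt`,
    -- `p_j = pElt x (j-1)`, so `p_{i+1} = pElt x i` and `n_j = x (pElt x (j-1))`.
    (i : ℕ) (hi2 : 2 ≤ i) (hil : i < x.support.card)
    -- `lcm(p₁, …, p_{i+1}) = p_{i+1}`
    (hlcm : (Finset.range (i + 1)).lcm (pElt x) = pElt x i) :
    (∑ j ∈ Finset.range (i + 1), pElt x j * x (pElt x j)) ^ w =
      pElt x i * b (pElt x i) +
        ∑ k ∈ (Finset.Nat.antidiagonalTuple i w).filter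
            (fun k => (Finset.univ.filter (fun j => k j ≠ 0)).lcm
              (fun j : Fin i => pElt x j.val) ≠ pElt x i),
          Nat.multinomial Finset.univ k * ∏ j, (pElt x j.val * x (pElt x j.val)) ^ k j := by
  subst heq
  set P := pElt x i with hP
  have hP0 : P ≠ 0 := (hx _ (pElt_mem_support x hil)).ne'
  have hdvd : ∀ j < i + 1, pElt x j ∣ P := fun j hj =>
    hlcm ▸ Finset.dvd_lcm (Finset.mem_range.2 hj)
  set L : (Fin i → ℕ) → ℕ := fun k =>
    (Finset.univ.filter (fun j => k j ≠ 0)).lcm (fun j : Fin i => pElt x j.val) with hL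
  set t : (Fin i → ℕ) → ℕ := fun k =>
    Nat.multinomial Finset.univ k * ∏ j, (pElt x j.val * x (pElt x j.val)) ^ k j with ht
  set T : ℕ → ℕ := fun d => ∑ k ∈ (Finset.Nat.antidiagonalTuple i w).filter (L · = d), t k with hT
  have hLP : ∀ k, L k ∣ P := fun k =>
    Finset.lcm_dvd fun j _ => hdvd j (j.2.trans i.lt_succ_self)
  have hpoint : ∀ r ∈ P.properDivisors, r * cycPow x w r = T r := by
    refine eq_of_sum_divisors_eq fun r hr => ?_
    rw [Nat.mem_properDivisors] at hr
    have hr0 : r ≠ 0 := ne_zero_of_dvd_ne_zero hP0 hr.1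
    rw [sum_divisors_mul_cycPow hr0, sum_divisors_mul_eq_sum_pElt x hil hr0 hr.2.le,
      Finset.sum_range_succ, if_neg (Nat.not_dvd_of_pos_of_lt (Nat.pos_of_ne_zero hr0) hr.2),
      add_zero, Finset.sum_range, ← sum_multinomial_filter_lcm_dvd w r
        (fun j : Fin i => pElt x j) (fun j => pElt x j * x (pElt x j)), hT,
      ← Finset.sum_fiberwise_of_maps_to (g := L) (t := r.divisors)]
    · refine Finset.sum_congr rfl fun d hd => Finset.sum_congr ?_ fun _ _ => rfl
      ext k
      simp only [Finset.mem_filter]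
      have := Nat.dvd_of_mem_divisors hd
      constructor
      · exact fun h => ⟨h.1.1, h.2⟩
      · exact fun h => ⟨⟨h.1, h.2.dvd.trans this⟩, h.2⟩
    · intro k hk
      exact Nat.mem_divisors.2 ⟨(Finset.mem_filter.1 hk).2, hr0⟩
  have hQ : ∑ k ∈ (Finset.Nat.antidiagonalTuple i w).filter (L · ≠ P), t k =
      ∑ d ∈ P.properDivisors, T d := by
    rw [hT, ← Finset.sum_fiberwise_of_maps_to (g := L) (t := P.properDivisors)]
    · refine Finset.sum_congr rfl fun d hd => Finset.sum_congr ?_ fun _ _ => rfl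
      ext k
      simp only [Finset.mem_filter]
      have := (Nat.mem_properDivisors.1 hd).2.ne
      constructor
      · exact fun h => ⟨h.1.1, h.2⟩
      · exact fun h => ⟨⟨h.1, h.2.symm ▸ this⟩, h.2⟩
    · intro k hk
      exact Nat.mem_properDivisors.2 ⟨hLP k,
        (Nat.le_of_dvd (Nat.pos_of_ne_zero hP0) (hLP k)).lt_of_ne (Finset.mem_filter.1 hk).2⟩
  have hsum : ∑ j ∈ Finset.range (i + 1), pElt x j * x (pElt x j) =
      ∑ d ∈ P.divisors, d * x d := by
    rw [sum_divisors_mul_eq_sum_pElt x hil hP0 le_rfl]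
    exact Finset.sum_congr rfl fun j hj => (if_pos (hdvd j (Finset.mem_range.1 hj))).symm
  rw [hQ, hsum, ← sum_divisors_mul_cycPow hP0, ← Nat.cons_self_properDivisors hP0, Finset.sum_cons,
    Finset.sum_congr rfl hpoint]
end

section
/- Let w ≥ 2 and let x, b : ℕ →₀ ℕ have supports containing only positive integers, with x^{⊙w} = b. Write x.support = {p₁ < p₂ < … < p_l}, set n_j = x p_j, and fix i with 2 ≤ i < l. Suppose lcm(p₁, …, p_{i+1}) > p_{i+1}, and let D = { j ∈ {1,…,i} : p_j divides p_{i+1} }. Then (∑_{j ∈ D} p_j * n_j + p_{i+1} * n_{i+1})^w = p_{i+1} * (b p_{i+1}) + Q**, where Q** = ∑ over all k : D → ℕ with ∑_{j ∈ D} k_j = w and lcm{ p_j : j ∈ D, k_j ≠ 0 } ≠ p_{i+1} of (Nat.multinomial coefficient of k) * ∏_{j ∈ D} (p_j * n_j)^(k_j). (Equivalently, n_{i+1} = (ʷ√(p_{i+1}·b(p_{i+1}) + Q**) − ∑_{j ∈ D} p_j n_j) / p_{i+1}.) -/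
open Finset

/-- The number of points lying on cycles whose length divides `r`. -/
noncomputable def pointsDvd (r : ℕ) : (ℕ →₀ ℕ) →+ ℕ :=
  Finsupp.liftAddHom fun s => AddMonoidHom.mulLeft (if s ∣ r then s else 0)

lemma pointsDvd_apply (r : ℕ) (f : ℕ →₀ ℕ) :
    pointsDvd r f = ∑ s ∈ f.support, (if s ∣ r then s else 0) * f s := rfl

lemma pointsDvd_single (r s n : ℕ) :
    pointsDvd r (Finsupp.single s n) = (if s ∣ r then s else 0) * n := by
  simp [pointsDvd]

lemma pointsDvd_eq_sum_divisors {r : ℕ} (hr : r ≠ 0) (f : ℕ →₀ ℕ) :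
    pointsDvd r f = ∑ s ∈ r.divisors, s * f s := by
  simp only [pointsDvd_apply, ite_mul, zero_mul]
  rw [← sum_filter]
  apply sum_subset_zero_on_sdiff
  · intro s hs
    simp only [mem_filter] at hs
    exact Nat.mem_divisors.2 ⟨hs.2, hr⟩
  · intro s hs
    simp only [mem_sdiff, Nat.mem_divisors, mem_filter, Finsupp.mem_support_iff] at hs
    rw [mul_eq_zero]
    tauto
  · simp

lemma pointsDvd_cycProd (r : ℕ) (f g : ℕ →₀ ℕ) :
    pointsDvd r (cycProd f g) = pointsDvd r f * pointsDvd r g := by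
  simp only [cycProd, map_sum, pointsDvd_single]
  rw [pointsDvd_apply, pointsDvd_apply, sum_mul_sum]
  refine sum_congr rfl fun p _ => sum_congr rfl fun q _ => ?_
  have h : Nat.lcm p q * (p * q / Nat.lcm p q) = p * q :=
    Nat.mul_div_cancel' (Nat.lcm_dvd_mul p q)
  by_cases hp : p ∣ r <;> by_cases hq : q ∣ r <;> simp only [Nat.lcm_dvd_iff, hp, hq, and_true,
    and_false, if_true, if_false, zero_mul, mul_zero]
  linear_combination f p * g q * h

lemma pointsDvd_cycPow (r : ℕ) (f : ℕ →₀ ℕ) (w : ℕ) :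
    pointsDvd r (cycPow f w) = pointsDvd r f ^ w := by
  induction w with
  | zero => simp [cycPow, pointsDvd_single]
  | succ w ih => rw [cycPow, pointsDvd_cycProd, ih, pow_succ']

lemma eq_of_sum_divisors_eq_s16 {F G : ℕ → ℕ}
    (h : ∀ r, r ≠ 0 → ∑ s ∈ r.divisors, F s = ∑ s ∈ r.divisors, G s) (r : ℕ) (hr : r ≠ 0) :
    F r = G r := by
  induction r using Nat.strong_induction_on with
  | _ r ih =>
    have h' := h r hr
    rw [← Nat.insert_self_properDivisors hr, sum_insert Nat.self_notMem_properDivisors,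
      sum_insert Nat.self_notMem_properDivisors] at h'
    have : ∑ s ∈ r.properDivisors, F s = ∑ s ∈ r.properDivisors, G s :=
      sum_congr rfl fun s hs => ih s (Nat.mem_properDivisors.1 hs).2
        (Nat.pos_of_mem_properDivisors hs).ne'
    omega

/-- The term of the multinomial expansion of a power of `∑ j, a j` with exponents `k`. -/
noncomputable def multinomialTerm {ι : Type*} (a : ι → ℕ) (k : ι →₀ ℕ) : ℕ :=
  k.multinomial * k.prod fun j e => a j ^ e

lemma multinomialTerm_eq {ι : Type*} (a : ι → ℕ) {k : ι →₀ ℕ} {s : Finset ι} (h : k.support ⊆ s) :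
    multinomialTerm a k = Nat.multinomial s k * ∏ j ∈ s, a j ^ k j := by
  rw [multinomialTerm, Finsupp.multinomial_eq_of_support_subset h,
    Finsupp.prod_of_support_subset _ h _ (by simp)]

section
variable {ι : Type*} [DecidableEq ι]

lemma sum_pow_eq_sum_multinomialTerm (a : ι → ℕ) (s : Finset ι) (w : ℕ) :
    (∑ j ∈ s, a j) ^ w = ∑ k ∈ finsuppAntidiag s w, multinomialTerm a k := by
  rw [sum_pow_eq_sum_piAntidiag]
  symm
  refine sum_bij (fun k _ => ⇑k) ?_ (fun _ _ _ _ h => DFunLike.coe_injective h) ?_ ?_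
  · intro k hk
    rw [mem_finsuppAntidiag] at hk
    exact mem_piAntidiag.2 ⟨hk.1, fun j hj => hk.2 (Finsupp.mem_support_iff.2 hj)⟩
  · intro k hk
    rw [mem_piAntidiag] at hk
    exact ⟨Finsupp.onFinset s k hk.2, mem_finsuppAntidiag.2
      ⟨hk.1, Finsupp.support_onFinset_subset⟩, rfl⟩
  · intro k hk
    exact multinomialTerm_eq a (mem_finsuppAntidiag.1 hk).2

lemma filter_lcm_dvd_finsuppAntidiag (s : Finset ι) (p : ι → ℕ) (r w : ℕ) :
    (finsuppAntidiag s w).filter (fun k => k.support.lcm p ∣ r) =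
      finsuppAntidiag (s.filter fun j => p j ∣ r) w := by
  ext k
  simp only [mem_filter, mem_finsuppAntidiag', Finset.lcm_dvd_iff, subset_iff]
  grind

/-- The number of points of a cycle power on cycles of length `r`, as a sum over the choices of
the cycles whose lengths have least common multiple `r`. -/
theorem mul_cycPow_apply (x : ℕ →₀ ℕ) (s : Finset ι) (p : ι → ℕ) (hinj : Set.InjOn p s)
    (himg : s.image p = x.support) (w r : ℕ) (hr : r ≠ 0) :
    r * cycPow x w r = ∑ k ∈ (finsuppAntidiag s w).filter (fun k => k.support.lcm p = r),
      multinomialTerm (fun j => p j * x (p j)) k := by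
  refine eq_of_sum_divisors_eq_s16 (F := fun r => r * cycPow x w r)
    (G := fun r => ∑ k ∈ (finsuppAntidiag s w).filter (fun k => k.support.lcm p = r),
      multinomialTerm (fun j => p j * x (p j)) k) (fun r hr => ?_) r hr
  have h₁ : pointsDvd r x = ∑ j ∈ s.filter (fun j => p j ∣ r), p j * x (p j) := by
    rw [pointsDvd_apply, ← himg, sum_image hinj, sum_filter]
    simp only [ite_mul, zero_mul]
  rw [← pointsDvd_eq_sum_divisors hr, pointsDvd_cycPow, h₁, sum_pow_eq_sum_multinomialTerm,
    ← filter_lcm_dvd_finsuppAntidiag, sum_fiberwise_eq_sum_filter]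
  simp only [Nat.mem_divisors, hr, ne_eq, not_false_eq_true, and_true]

end

lemma pElt_eq_getElem (x : ℕ →₀ ℕ) {j : ℕ} (hj : j < x.support.card) :
    pElt x j = (x.support.sort (· ≤ ·))[j]'(by simpa using hj) := by
  simp [pElt, hj]

lemma strictMonoOn_pElt (x : ℕ →₀ ℕ) : StrictMonoOn (pElt x) (range x.support.card) := by
  intro a ha b hb hab
  rw [pElt_eq_getElem x (by simpa using ha), pElt_eq_getElem x (by simpa using hb)]
  exact (sortedLT_sort x.support).strictMono_get hab

lemma image_pElt (x : ℕ →₀ ℕ) : (range x.support.card).image (pElt x) = x.support := by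
  ext q
  rw [mem_image, ← Finset.mem_sort (s := x.support) (· ≤ ·), List.mem_iff_getElem]
  simp only [mem_range, length_sort]
  constructor
  · rintro ⟨j, hj, rfl⟩
    exact ⟨j, hj, (pElt_eq_getElem x hj).symm⟩
  · rintro ⟨j, hj, rfl⟩
    exact ⟨j, hj, pElt_eq_getElem x hj⟩

theorem stmt_16 (w : ℕ) (hw : 2 ≤ w) (x b : ℕ →₀ ℕ)
    (hx : ∀ p ∈ x.support, 0 < p) (hb : ∀ p ∈ b.support, 0 < p)
    (heq : cycPow x w = b)
    -- `i` is the paper's index: `2 ≤ i < l`; with the `0`-based `pElt`,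
    -- `p_j = pElt x (j-1)`, so `p_{i+1} = pElt x i` and `n_j = x (pElt x (j-1))`.
    (i : ℕ) (hi2 : 2 ≤ i) (hil : i < x.support.card)
    -- `lcm(p₁, …, p_{i+1}) > p_{i+1}`
    (hlcm : pElt x i < (Finset.range (i + 1)).lcm (pElt x)) :
    -- `D = { j ∈ {1,…,i} : p_j ∣ p_{i+1} }`, `0`-based
    (∑ j ∈ (Finset.range i).filter (fun j => pElt x j ∣ pElt x i),
        pElt x j * x (pElt x j) + pElt x i * x (pElt x i)) ^ w =
      pElt x i * b (pElt x i) +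
        ∑ k ∈ (Finset.finsuppAntidiag
              ((Finset.range i).filter (fun j => pElt x j ∣ pElt x i)) w).filter
            (fun k => (((Finset.range i).filter (fun j => pElt x j ∣ pElt x i)).filter
              (fun j => k j ≠ 0)).lcm (pElt x) ≠ pElt x i),
          Nat.multinomial ((Finset.range i).filter (fun j => pElt x j ∣ pElt x i)) k *
            ∏ j ∈ (Finset.range i).filter (fun j => pElt x j ∣ pElt x i),
              (pElt x j * x (pElt x j)) ^ k j := by
  subst heq
  have hmem : pElt x i ∈ x.support :=
    image_pElt x ▸ mem_image_of_mem _ (mem_range.2 hil)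
  have hr := hx _ hmem
  have hmono := strictMonoOn_pElt x
  rw [mul_cycPow_apply x _ _ hmono.injOn (image_pElt x) w _ hr.ne']
  set D := (range i).filter (fun j => pElt x j ∣ pElt x i) with hD
  set a := fun j => pElt x j * x (pElt x j) with ha
  have hiD : i ∉ D := by simp [hD]
  have hins : (range x.support.card).filter (fun j => pElt x j ∣ pElt x i) = insert i D := by
    ext j
    simp only [hD, mem_filter, mem_range, mem_insert]
    constructor
    · rintro ⟨hj, hdvd⟩
      rcases lt_trichotomy j i with h | h | h
      · exact Or.inr ⟨h, hdvd⟩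
      · exact Or.inl h
      · have := hmono (by simpa using hil) (by simpa using hj) h
        exact absurd (Nat.le_of_dvd hr hdvd) this.not_ge
    · rintro (rfl | ⟨hj, hdvd⟩)
      · exact ⟨hil, dvd_rfl⟩
      · exact ⟨hj.trans hil, hdvd⟩
  have hsum : ∑ j ∈ D, a j + a i = ∑ j ∈ insert i D, a j := by
    rw [sum_insert hiD, add_comm]
  change (∑ j ∈ D, a j + a i) ^ w = _
  rw [hsum, sum_pow_eq_sum_multinomialTerm,
    ← sum_filter_add_sum_filter_not _ (fun k : ℕ →₀ ℕ => k.support.lcm (pElt x) = pElt x i)]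
  congr 1
  · refine sum_congr ?_ fun _ _ => rfl
    rw [← hins, ← filter_lcm_dvd_finsuppAntidiag, filter_filter]
    exact filter_congr fun k _ => ⟨fun h => h.2, fun h => ⟨h.dvd, h⟩⟩
  · have hsupp : ∀ k ∈ finsuppAntidiag D w, D.filter (fun j => k j ≠ 0) = k.support := by
      intro k hk
      ext j
      have := @(mem_finsuppAntidiag.1 hk).2 j
      simp only [Finsupp.mem_support_iff] at this
      simpa using this
    refine sum_congr ?_ fun k hk => ?_
    · rw [filter_congr (s := finsuppAntidiag D w) (q := fun k : ℕ →₀ ℕ =>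
        k.support.lcm (pElt x) ≠ pElt x i) fun k hk => by rw [hsupp k hk]]
      apply Subset.antisymm
      · intro k hk
        rw [mem_filter, ← hins, ← filter_lcm_dvd_finsuppAntidiag, mem_filter] at hk
        obtain ⟨⟨hk, hdvd⟩, hne⟩ := hk
        have hki : i ∉ k.support := fun h => hne (Nat.dvd_antisymm hdvd (dvd_lcm h))
        have hk' : k ∈ finsuppAntidiag (insert i D) w := by
          rw [← hins, ← filter_lcm_dvd_finsuppAntidiag]
          exact mem_filter.2 ⟨hk, hdvd⟩
        rw [mem_finsuppAntidiag'] at hk'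
        exact mem_filter.2 ⟨mem_finsuppAntidiag'.2
          ⟨hk'.1, (subset_insert_iff_of_notMem hki).1 hk'.2⟩, hne⟩
      · exact filter_subset_filter _ (finsuppAntidiag_mono (subset_insert i D) w)
    · exact multinomialTerm_eq a (mem_finsuppAntidiag.1 (mem_filter.1 hk).1).2
end

section
/- Let p, p', q, r be positive natural numbers with p dividing q. Then the cycle product of Finsupp.single p 1 and Finsupp.single p' 1 equals Finsupp.single q r if and only if all of the following hold: r divides q, p' = (q / p) * r, Nat.gcd p p' = r, and Nat.lcm p p' = q. (In the paper's terms: one cycle of length p' gives rise to exactly r cycles of length q when multiplied by C¹_p iff r ∣ q, p' = (q/p)·r, gcd(p, (q/p)·r) = r and lcm(p, (q/p)·r) = q; such r is called a feasible divisor of q.) -/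
theorem cycProd_single_single_s18 {p p' : ℕ} (hp : 0 < p) (hp' : 0 < p') :
    cycProd (Finsupp.single p 1) (Finsupp.single p' 1) =
      Finsupp.single (Nat.lcm p p') (Nat.gcd p p') := by
  have hdiv : p * p' / Nat.lcm p p' = Nat.gcd p p' := by
    rw [← Nat.gcd_mul_lcm p p', Nat.mul_div_cancel _ (Nat.lcm_pos hp hp')]
  simp only [cycProd, Finsupp.support_single _ one_ne_zero, Finset.sum_singleton,
    Finsupp.single_eq_same, one_mul, hdiv]

theorem stmt_18 (p p' q r : ℕ) (hp : 0 < p) (hp' : 0 < p') (hq : 0 < q) (hr : 0 < r)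
    (hpq : p ∣ q) :
    cycProd (Finsupp.single p 1) (Finsupp.single p' 1) = Finsupp.single q r ↔
      (r ∣ q ∧ p' = q / p * r ∧ Nat.gcd p p' = r ∧ Nat.lcm p p' = q) := by
  rw [cycProd_single_single_s18 hp hp', Finsupp.single_eq_single_iff]
  constructor
  · rintro (⟨hlcm, hgcd⟩ | ⟨-, hr0⟩)
    · refine ⟨hgcd ▸ (Nat.gcd_dvd_left p p').trans hpq, ?_, hgcd, hlcm⟩
      have hmul := Nat.gcd_mul_lcm p p'
      rw [hgcd, hlcm] at hmul
      obtain ⟨k, rfl⟩ := hpq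
      rw [Nat.mul_div_cancel_left k hp]
      exact Nat.eq_of_mul_eq_mul_left hp (by rw [← hmul]; ring)
    · exact absurd hr0 hr.ne'
  · rintro ⟨-, -, hgcd, hlcm⟩
    exact Or.inl ⟨hlcm, hgcd⟩
end

section
/- Let p, q, n be positive natural numbers with p dividing q, and let D = { d : ℕ | 0 < d ∧ d ∣ q ∧ Nat.gcd p ((q / p) * d) = d ∧ Nat.lcm p ((q / p) * d) = q } be the set of feasible divisors of q. Then the basic equation C¹_p ⊙ X = C^n_q has a solution — i.e. there exists x : ℕ →₀ ℕ with support containing only positive integers such that the cycle product of Finsupp.single p 1 and x equals Finsupp.single q n — if and only if there exists y : ℕ →₀ ℕ with y.support ⊆ D and ∑_{d ∈ y.support} d * y d = n. -/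
theorem cycProd_single_one {p : ℕ} (hp : 0 < p) {x : ℕ →₀ ℕ} (hx : ∀ a ∈ x.support, 0 < a) :
    cycProd (Finsupp.single p 1) x =
      ∑ a ∈ x.support, Finsupp.single (Nat.lcm p a) (Nat.gcd p a * x a) := by
  rw [cycProd, Finsupp.support_single p one_ne_zero, Finset.sum_singleton]
  refine Finset.sum_congr rfl fun a ha => ?_
  rw [← Nat.gcd_mul_lcm p a, Nat.mul_div_cancel _ (Nat.lcm_pos hp (hx a ha)),
    Finsupp.single_eq_same, one_mul, mul_comm]

theorem cycProd_single_one_of_lcm_eq {p q : ℕ} (hp : 0 < p) {x : ℕ →₀ ℕ}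
    (hx : ∀ a ∈ x.support, 0 < a) (hq : ∀ a ∈ x.support, Nat.lcm p a = q) :
    cycProd (Finsupp.single p 1) x =
      Finsupp.single q (∑ a ∈ x.support, Nat.gcd p a * x a) := by
  rw [cycProd_single_one hp hx, Finsupp.single_finsetSum]
  exact Finset.sum_congr rfl fun a ha => by rw [hq a ha]

theorem lcm_eq_of_cycProd_eq_single {p q n : ℕ} (hp : 0 < p) {x : ℕ →₀ ℕ}
    (hx : ∀ a ∈ x.support, 0 < a)
    (h : cycProd (Finsupp.single p 1) x = Finsupp.single q n) {a : ℕ} (ha : a ∈ x.support) :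
    Nat.lcm p a = q := by
  by_contra hne
  have h0 : cycProd (Finsupp.single p 1) x (Nat.lcm p a) = 0 := by
    rw [h, Finsupp.single_eq_of_ne hne]
  rw [cycProd_single_one hp hx, Finsupp.finsetSum_apply, Finset.sum_eq_zero_iff] at h0
  have h1 := h0 a ha
  rw [Finsupp.single_eq_same, mul_eq_zero] at h1
  exact h1.elim (Nat.gcd_pos_of_pos_left a hp).ne' (Finsupp.mem_support_iff.mp ha)

/-- A cycle length is recovered from its gcd and lcm with `p`. -/
theorem lcm_div_mul_gcd {p : ℕ} (hp : 0 < p) (a : ℕ) :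
    Nat.lcm p a / p * Nat.gcd p a = a := by
  apply Nat.eq_of_mul_eq_mul_left hp
  rw [← mul_assoc, Nat.mul_div_cancel' (Nat.dvd_lcm_left p a), mul_comm, Nat.gcd_mul_lcm]

theorem stmt_19 (p q n : ℕ) (hp : 0 < p) (hq : 0 < q) (hn : 0 < n) (hpq : p ∣ q) :
    (∃ x : ℕ →₀ ℕ, (∀ a ∈ x.support, 0 < a) ∧
        cycProd (Finsupp.single p 1) x = Finsupp.single q n) ↔
      ∃ y : ℕ →₀ ℕ,
        (↑y.support : Set ℕ) ⊆
            {d : ℕ | 0 < d ∧ d ∣ q ∧ Nat.gcd p (q / p * d) = d ∧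
              Nat.lcm p (q / p * d) = q} ∧
          ∑ d ∈ y.support, d * y d = n := by
  have hk : 0 < q / p := Nat.div_pos (Nat.le_of_dvd hq hpq) hp
  let e : ℕ ↪ ℕ := ⟨fun d => q / p * d, fun _ _ h => Nat.eq_of_mul_eq_mul_left hk h⟩
  constructor
  · rintro ⟨x, hx, h⟩
    have hl : ∀ a ∈ x.support, Nat.lcm p a = q :=
      fun a ha => lcm_eq_of_cycProd_eq_single hp hx h ha
    have he : ∀ a ∈ x.support, q / p * Nat.gcd p a = a := fun a ha => by
      conv_lhs => rw [← hl a ha]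
      exact lcm_div_mul_gcd hp a
    have hsum : ∑ a ∈ x.support, Nat.gcd p a * x a = n := by
      rw [cycProd_single_one_of_lcm_eq hp hx hl] at h
      exact Finsupp.single_injective q h
    obtain ⟨y, rfl⟩ : ∃ y : ℕ →₀ ℕ, y.embDomain e = x := by
      refine ⟨x.comapDomain e e.injective.injOn, ?_⟩
      rw [Finsupp.embDomain_eq_mapDomain]
      exact Finsupp.mapDomain_comapDomain e e.injective x
        fun a ha => ⟨Nat.gcd p a, he a ha⟩
    have hmem : ∀ d ∈ y.support, e d ∈ (y.embDomain e).support := fun d hd => by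
      rw [Finsupp.support_embDomain]
      exact Finset.mem_map_of_mem e hd
    have hg : ∀ d ∈ y.support, Nat.gcd p (e d) = d :=
      fun d hd => e.injective (he (e d) (hmem d hd))
    refine ⟨y, fun d hd => ⟨?_, ?_, hg d hd, hl _ (hmem d hd)⟩, ?_⟩
    · exact hg d hd ▸ Nat.gcd_pos_of_pos_left _ hp
    · exact hg d hd ▸ (Nat.gcd_dvd_left _ _).trans hpq
    · rw [Finsupp.support_embDomain, Finset.sum_map] at hsum
      rw [← hsum]
      exact Finset.sum_congr rfl fun d hd => by
        rw [Finsupp.embDomain_apply_self, hg d hd]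
  · rintro ⟨y, hy, hsum⟩
    have hx : ∀ a ∈ (y.embDomain e).support, 0 < a := by
      simp only [Finsupp.support_embDomain, Finset.mem_map]
      rintro _ ⟨d, hd, rfl⟩
      exact Nat.mul_pos hk (hy hd).1
    have hl : ∀ a ∈ (y.embDomain e).support, Nat.lcm p a = q := by
      simp only [Finsupp.support_embDomain, Finset.mem_map]
      rintro _ ⟨d, hd, rfl⟩
      exact (hy hd).2.2.2
    refine ⟨y.embDomain e, hx, ?_⟩
    rw [cycProd_single_one_of_lcm_eq hp hx hl, ← hsum, Finsupp.support_embDomain,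
      Finset.sum_map]
    congr 1
    refine Finset.sum_congr rfl fun d hd => ?_
    rw [Finsupp.embDomain_apply_self]
    exact congrArg (· * y d) (hy hd).2.2.1
end
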